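/- arXiv:2308.04341 — 4 statements merged into one kernel-verified Lean document; each statement's English description precedes it below -/
import Mathlib

section
/- (Laplace mechanism is ε-DP.) Let ε > 0, Δ > 0, and let a, a' ∈ ℝ be two possible values of a real-valued query on adjacent datasets, with |a − a'| ≤ Δ (global sensitivity bound). Let μ = Lap(a, Δ/ε) and μ' = Lap(a', Δ/ε) be the output distributions of the Laplace mechanism, i.e. Lebesgue measure on ℝ with densities x ↦ (ε/(2Δ)) · exp(−ε|x − a|/Δ) and x ↦ (ε/(2Δ)) · exp(−ε|x − a'|/Δ) respectively. Then for every measurable set S ⊆ ℝ, μ(S) ≤ e^ε · μ'(S). -/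
open MeasureTheory Real

/-- The Laplace measure with location `m` and scale `b`: Lebesgue measure on ℝ with
density `x ↦ (1/(2b)) · exp (−|x − m|/b)`. -/
noncomputable def laplaceMeasure (m b : ℝ) : Measure ℝ :=
  volume.withDensity fun x => ENNReal.ofReal ((1 / (2 * b)) * Real.exp (-|x - m| / b))

/-- The Laplace mechanism with scale `Δ/ε` on a query of global sensitivity `Δ`
is ε-differentially private: for adjacent query values `a, a'` with `|a − a'| ≤ Δ`,
the two output distributions satisfy the ε-DP inequality. -/
theorem laplace_mechanism_dp (ε Δ a a' : ℝ) (hε : 0 < ε) (hΔ : 0 < Δ)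
    (h : |a - a'| ≤ Δ) :
    ∀ S : Set ℝ, MeasurableSet S →
      laplaceMeasure a (Δ / ε) S ≤
        ENNReal.ofReal (Real.exp ε) * laplaceMeasure a' (Δ / ε) S := by
  intro S hS
  have hb : 0 < Δ / ε := div_pos hΔ hε
  rw [laplaceMeasure, laplaceMeasure, withDensity_apply _ hS, withDensity_apply _ hS,
    ← lintegral_const_mul' _ _ ENNReal.ofReal_ne_top]
  refine lintegral_mono fun x => ?_
  rw [← ENNReal.ofReal_mul (Real.exp_pos ε).le]
  refine ENNReal.ofReal_le_ofReal ?_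
  rw [mul_left_comm, ← Real.exp_add]
  gcongr
  have htri : |x - a'| ≤ |x - a| + Δ := (abs_sub_le x a a').trans (by gcongr)
  calc -|x - a| / (Δ / ε) ≤ (Δ + -|x - a'|) / (Δ / ε) := by
        gcongr
        linarith
    _ = ε + -|x - a'| / (Δ / ε) := by
        rw [add_div, div_div_cancel₀ hΔ.ne']
end

section
/- (The Laplace Recourse mechanism is ε-DP, concrete form.) Fix ε > 0, a target score s ∈ ℝ, and a nonzero weight vector w in Euclidean space ℝ^d. Define the post-processing map G : ℝ → ℝ^d by G(z) = ((s − log(c/(1 − c))) / ‖w‖²) • w, where c = min(1, max(0, z)) is z clamped to [0, 1] (with the convention that log and division take junk values at c = 0 and c = 1). Then G is measurable, and for any p, p' ∈ [0, 1], the pushforwards of the Laplace measures Lap(p, 1/ε) and Lap(p', 1/ε) under G satisfy: for every measurable set T ⊆ ℝ^d, (Lap(p, 1/ε).map G)(T) ≤ e^ε · (Lap(p', 1/ε).map G)(T). -/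
open MeasureTheory Real

/-- Laplace measures of equal scale are comparable, with ratio controlled by the distance
between their locations. -/
theorem laplaceMeasure_le_smul (m m' : ℝ) {b : ℝ} (hb : 0 ≤ b) :
    laplaceMeasure m b ≤
      ENNReal.ofReal (Real.exp (|m - m'| / b)) • laplaceMeasure m' b := by
  unfold laplaceMeasure
  rw [← withDensity_smul _ (by fun_prop)]
  refine withDensity_mono (Filter.Eventually.of_forall fun x => ?_)
  rw [Pi.smul_apply, smul_eq_mul, ← ENNReal.ofReal_mul (Real.exp_pos _).le]
  apply ENNReal.ofReal_le_ofReal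
  rw [mul_left_comm, ← Real.exp_add, ← add_div]
  gcongr
  linarith [abs_sub_le x m m']

/-- The Laplace Recourse mechanism is ε-DP (concrete form): the post-processing map
`G` (clamp the noisy score to `[0,1]`, convert to a logistic-regression score, and
compute the counterfactual displacement) is measurable, and the pushforwards of the
Laplace mechanisms centered at two adjacent predicted probabilities satisfy the
ε-DP inequality. -/
theorem laplace_recourse_dp_concrete {d : ℕ} (ε s : ℝ) (hε : 0 < ε)
    (w : EuclideanSpace ℝ (Fin d)) (hw : w ≠ 0)
    (G : ℝ → EuclideanSpace ℝ (Fin d))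
    (hGdef : ∀ z : ℝ, G z =
      ((s - Real.log (min 1 (max 0 z) / (1 - min 1 (max 0 z)))) / ‖w‖ ^ 2) • w)
    (p p' : ℝ) (hp : p ∈ Set.Icc (0 : ℝ) 1) (hp' : p' ∈ Set.Icc (0 : ℝ) 1) :
    Measurable G ∧
      ∀ T : Set (EuclideanSpace ℝ (Fin d)), MeasurableSet T →
        (laplaceMeasure p (1 / ε)).map G T ≤
          ENNReal.ofReal (Real.exp ε) * (laplaceMeasure p' (1 / ε)).map G T := by
  have hG : Measurable G := by
    rw [funext hGdef]
    fun_prop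
  refine ⟨hG, fun T hT => ?_⟩
  have hdist : |p - p'| ≤ 1 := abs_sub_le_iff.2
    ⟨by linarith [hp.2, hp'.1], by linarith [hp.1, hp'.2]⟩
  rw [Measure.map_apply hG hT, Measure.map_apply hG hT]
  refine (laplaceMeasure_le_smul p p' (one_div_pos.2 hε).le _).trans ?_
  rw [Measure.smul_apply, smul_eq_mul]
  gcongr
  rw [div_div_eq_mul_div, div_one]
  exact mul_le_of_le_one_left hε.le hdist
end

section
/- (Membership advantage bound.) Let μ and μ' be probability measures on a measurable space, let ε ≥ 0, and let S be a measurable set with μ(S) ≤ e^ε · μ'(S). Then μ(S) − μ'(S) ≤ 1 − e^{−ε}. (Interpreting μ(S) as the true positive rate and μ'(S) as the false positive rate of a membership inference attack with acceptance region S, the attack's advantage TPR − FPR is at most 1 − e^{−ε}.) -/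
open MeasureTheory Real

/-- Membership advantage bound: if two probability measures satisfy the ε-DP
inequality on an acceptance region `S`, the attack advantage `TPR − FPR`
is at most `1 − e^{−ε}`. -/
theorem membership_advantage_bound {Ω : Type*} [MeasurableSpace Ω]
    (μ μ' : Measure Ω) [IsProbabilityMeasure μ] [IsProbabilityMeasure μ']
    (ε : ℝ) (hε : 0 ≤ ε) (S : Set Ω) (hS : MeasurableSet S)
    (h : μ S ≤ ENNReal.ofReal (Real.exp ε) * μ' S) :
    (μ S).toReal - (μ' S).toReal ≤ 1 - Real.exp (-ε) := by
  have hreal : (μ S).toReal ≤ Real.exp ε * (μ' S).toReal := by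
    have h_mono := ENNReal.toReal_mono
      (ENNReal.mul_ne_top ENNReal.ofReal_ne_top (measure_ne_top μ' S)) h
    rwa [ENNReal.toReal_mul, ENNReal.toReal_ofReal (Real.exp_pos ε).le] at h_mono
  have hle_one : (μ S).toReal ≤ 1 := measureReal_le_one
  have hexp : Real.exp (-ε) ≤ 1 := Real.exp_le_one_iff.mpr (neg_nonpos.mpr hε)
  have hscaled : Real.exp (-ε) * (μ S).toReal ≤ (μ' S).toReal := by
    rwa [Real.exp_neg, inv_mul_le_iff₀ (Real.exp_pos ε)]
  calc (μ S).toReal - (μ' S).toReal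
      ≤ (μ S).toReal * (1 - Real.exp (-ε)) := by linarith
    _ ≤ 1 - Real.exp (-ε) := mul_le_of_le_one_left (sub_nonneg.mpr hexp) hle_one
end

section
/- (Balanced accuracy bound for ε-DP recourse.) Let μ and μ' be probability measures on a measurable space (the output distributions of an ε-DP recourse mechanism on a training member and a non-member, respectively), and suppose that for every measurable set S, μ(S) ≤ e^ε · μ'(S), with ε ≥ 0. Then for every measurable acceptance region S, the balanced accuracy of the membership inference attack with acceptance region S satisfies (μ(S) + μ'(Sᶜ)) / 2 ≤ 1/2 + (1 − e^{−ε})/2, where Sᶜ denotes the complement of S. -/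
open MeasureTheory Real

/-- Balanced accuracy bound for ε-DP recourse: if the member and non-member output
distributions `μ, μ'` satisfy the ε-DP inequality for every measurable set, then the
balanced accuracy `(TPR + TNR)/2` of any membership inference attack with measurable
acceptance region `S` is at most `1/2 + (1 − e^{−ε})/2`. -/
theorem balanced_accuracy_bound {Ω : Type*} [MeasurableSpace Ω]
    (μ μ' : Measure Ω) [IsProbabilityMeasure μ] [IsProbabilityMeasure μ']
    (ε : ℝ) (hε : 0 ≤ ε)
    (hDP : ∀ S : Set Ω, MeasurableSet S →
      μ S ≤ ENNReal.ofReal (Real.exp ε) * μ' S) :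
    ∀ S : Set Ω, MeasurableSet S →
      ((μ S).toReal + (μ' Sᶜ).toReal) / 2 ≤ 1 / 2 + (1 - Real.exp (-ε)) / 2 := by
  intro S hS
  have hle : μ.real S ≤ exp ε * μ'.real S := by
    have h := ENNReal.toReal_mono (by finiteness) (hDP S hS)
    rwa [ENNReal.toReal_mul, ENNReal.toReal_ofReal (exp_pos ε).le] at h
  have hlower : exp (-ε) * μ.real S ≤ μ'.real S := by
    rwa [exp_neg, inv_mul_le_iff₀ (exp_pos ε)]
  have hexp : exp (-ε) ≤ 1 := exp_le_one_iff.mpr (neg_nonpos.mpr hε)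
  have hone : μ.real S ≤ 1 := measureReal_le_one
  have hcompl : μ'.real Sᶜ = 1 - μ'.real S := probReal_compl_eq_one_sub hS
  change (μ.real S + μ'.real Sᶜ) / 2 ≤ _
  rw [hcompl]
  nlinarith [mul_nonneg (sub_nonneg.mpr hexp) (sub_nonneg.mpr hone)]
end
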